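/- Let p > 1/2 and define for k ≥ 2: r'_k = (log 4)^{-p} 2^{-k-1} k^{-p} and R'_k = (log 4)^{-p} 2^{-k-1} (k-1)^{-p}. Then 0 < r'_k < R'_k, the sequence R'_{k+1} < r'_k (so each generation nests inside the previous), and 4^k · g(2 r'_k) is bounded below by a positive constant as k → ∞, where g(t) = t² (log(1/t))^{2p}. Consequently the associated Cantor set 𝒞' built with 4^k squares of side 2r'_k in generation k satisfies H^g(𝒞') > 0. -/

import Mathlib

open MeasureTheory

/-- Half side length `r'_k` of the generation-`k` squares of the Cantor set 𝒞'. -/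
noncomputable def cantorHalfSide (p : ℝ) (k : ℕ) : ℝ :=
  (Real.log 4) ^ (-p) * (2:ℝ) ^ (-(k:ℝ) - 1) * (k:ℝ) ^ (-p)

/-- Half side length `R'_k` of the generation-`k` auxiliary squares. -/
noncomputable def cantorOuterHalfSide (p : ℝ) (k : ℕ) : ℝ :=
  (Real.log 4) ^ (-p) * (2:ℝ) ^ (-(k:ℝ) - 1) * ((k:ℝ) - 1) ^ (-p)

/-- The gauge function `g(t) = t² (log(1/t))^{2p}`. -/
noncomputable def cantorGauge (p t : ℝ) : ℝ := t ^ 2 * (Real.log (1 / t)) ^ (2 * p)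

/-- The generalized Hausdorff measure `H^g` on `ℝ²` (sup metric) with gauge
`g(t) = t²(log(1/t))^{2p}`. -/
noncomputable def cantorHausdorffMeasure (p : ℝ) : Measure (ℝ × ℝ) :=
  Measure.mkMetric (fun t : ENNReal => ENNReal.ofReal (cantorGauge p t.toReal))

/-- Sign associated to a boolean digit. -/
def digitSign (b : Bool) : ℝ := if b then 1 else -1

/-- The point of the Cantor set 𝒞' addressed by `a : ℕ → Bool × Bool`: in
generation `k ≥ 2` the four children squares of side `2r'_{k+1}` are centered at
the centers of the four quarter-squares of their parent (side `2r'_k`), i.e. at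
offsets `(±r'_k/2, ±r'_k/2)` from the parent's center. -/
noncomputable def cantorPoint (p : ℝ) (a : ℕ → Bool × Bool) : ℝ × ℝ :=
  (∑' k : ℕ, if 2 ≤ k then digitSign (a k).1 * cantorHalfSide p k / 2 else 0,
   ∑' k : ℕ, if 2 ≤ k then digitSign (a k).2 * cantorHalfSide p k / 2 else 0)

open Filter Topology

lemma one_lt_log_four : 1 < Real.log 4 := by
  have h : Real.log 4 = 2 * Real.log 2 := by
    rw [show (4 : ℝ) = 2 ^ 2 by norm_num, Real.log_pow]; norm_num
  have := Real.log_two_gt_d9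
  linarith

lemma cantorHalfSide_pos (p : ℝ) {k : ℕ} (hk : 1 ≤ k) : 0 < cantorHalfSide p k := by
  have hL : 0 < Real.log 4 := one_pos.trans one_lt_log_four
  have hk' : (0 : ℝ) < k := by exact_mod_cast hk
  unfold cantorHalfSide
  positivity

lemma cantorHalfSide_lt_outer {p : ℝ} (hp : 0 < p) {k : ℕ} (hk : 2 ≤ k) :
    cantorHalfSide p k < cantorOuterHalfSide p k := by
  have hL : 0 < Real.log 4 := one_pos.trans one_lt_log_four
  have hk' : (2 : ℝ) ≤ k := by exact_mod_cast hk
  unfold cantorHalfSide cantorOuterHalfSide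
  have h : (k : ℝ) ^ (-p) < ((k : ℝ) - 1) ^ (-p) :=
    Real.rpow_lt_rpow_of_neg (by linarith) (by linarith) (by linarith)
  gcongr

lemma two_rpow_succ (k : ℕ) :
    (2 : ℝ) ^ (-((k + 1 : ℕ) : ℝ) - 1) = (2 : ℝ) ^ (-(k : ℝ) - 1) / 2 := by
  rw [show -((k + 1 : ℕ) : ℝ) - 1 = (-(k : ℝ) - 1) - 1 by push_cast; ring,
    Real.rpow_sub_one (by norm_num)]

lemma cantorOuterHalfSide_succ (p : ℝ) (k : ℕ) :
    cantorOuterHalfSide p (k + 1) = cantorHalfSide p k / 2 := by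
  unfold cantorHalfSide cantorOuterHalfSide
  rw [two_rpow_succ, show ((k + 1 : ℕ) : ℝ) - 1 = k by push_cast; ring]
  ring

lemma cantorHalfSide_succ_le {p : ℝ} (hp : 0 < p) {k : ℕ} (hk : 1 ≤ k) :
    2 * cantorHalfSide p (k + 1) ≤ cantorHalfSide p k := by
  have h := cantorHalfSide_lt_outer hp (show 2 ≤ k + 1 by omega)
  rw [cantorOuterHalfSide_succ] at h
  linarith

lemma le_cantorHalfSide_succ {p : ℝ} (hp : 0 < p) {k : ℕ} (hk : 1 ≤ k) :
    2 ^ (-p) / 2 * cantorHalfSide p k ≤ cantorHalfSide p (k + 1) := by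
  have hL : 0 < Real.log 4 := one_pos.trans one_lt_log_four
  have hk' : (1 : ℝ) ≤ k := by exact_mod_cast hk
  have h : (2 : ℝ) ^ (-p) * (k : ℝ) ^ (-p) ≤ ((k + 1 : ℕ) : ℝ) ^ (-p) := by
    rw [← Real.mul_rpow (by norm_num) (by linarith)]
    exact Real.rpow_le_rpow_of_nonpos (by positivity) (by push_cast; linarith) (by linarith)
  unfold cantorHalfSide
  rw [two_rpow_succ]
  calc _ = Real.log 4 ^ (-p) * ((2 : ℝ) ^ (-(k : ℝ) - 1) / 2) *
        ((2 : ℝ) ^ (-p) * (k : ℝ) ^ (-p)) := by ring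
    _ ≤ _ := by gcongr

lemma two_mul_cantorHalfSide (p : ℝ) (k : ℕ) :
    2 * cantorHalfSide p k = Real.log 4 ^ (-p) * (k : ℝ) ^ (-p) / 2 ^ k := by
  unfold cantorHalfSide
  rw [Real.rpow_sub_one (by norm_num), Real.rpow_neg (x := 2) (by norm_num), Real.rpow_natCast]
  field_simp

lemma two_mul_cantorHalfSide_le {p : ℝ} (hp : 0 < p) {k : ℕ} (hk : 1 ≤ k) :
    2 * cantorHalfSide p k ≤ (1 / 2) ^ k := by
  have hk' : (1 : ℝ) ≤ k := by exact_mod_cast hk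
  rw [two_mul_cantorHalfSide, one_div, inv_pow, div_eq_mul_inv]
  refine mul_le_of_le_one_left (by positivity) (mul_le_one₀ ?_ (by positivity) ?_)
  · exact Real.rpow_le_one_of_one_le_of_nonpos one_lt_log_four.le (by linarith)
  · exact Real.rpow_le_one_of_one_le_of_nonpos hk' (by linarith)

lemma le_log_inv_cantorHalfSide {p : ℝ} (hp : 0 < p) {k : ℕ} (hk : 1 ≤ k) :
    k * (Real.log 4 / 2) ≤ Real.log (1 / (2 * cantorHalfSide p k)) := by
  have h0 := cantorHalfSide_pos p hk
  have h : Real.log 4 = 2 * Real.log 2 := by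
    rw [show (4 : ℝ) = 2 ^ 2 by norm_num, Real.log_pow]; norm_num
  have h1 : (k : ℝ) * (Real.log 4 / 2) = Real.log (2 ^ k) := by rw [Real.log_pow, h]; ring
  rw [h1]
  refine Real.log_le_log (by positivity) ?_
  rw [le_div_iff₀ (by positivity)]
  calc (2 : ℝ) ^ k * (2 * cantorHalfSide p k) ≤ 2 ^ k * (1 / 2) ^ k := by
        gcongr; exact two_mul_cantorHalfSide_le hp hk
    _ = 1 := by rw [← mul_pow]; norm_num

lemma le_four_pow_mul_gauge {p : ℝ} (hp : 0 < p) {k : ℕ} (hk : 1 ≤ k) :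
    2 ^ (-(2 * p)) ≤ 4 ^ k * cantorGauge p (2 * cantorHalfSide p k) := by
  have hL : 0 < Real.log 4 := one_pos.trans one_lt_log_four
  have hk' : (0 : ℝ) < k := by exact_mod_cast hk
  have hsq : ∀ x : ℝ, 0 < x → (x ^ (-p)) ^ 2 * x ^ (2 * p) = 1 := fun x hx => by
    rw [← Real.rpow_natCast, ← Real.rpow_mul hx.le, ← Real.rpow_add hx]
    convert Real.rpow_zero x using 2
    push_cast; ring
  have h4 : (4 : ℝ) ^ k = (2 ^ k) ^ 2 := by rw [← pow_mul, mul_comm, pow_mul]; norm_num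
  have hlog := le_log_inv_cantorHalfSide hp hk
  unfold cantorGauge
  calc (2 : ℝ) ^ (-(2 * p))
      = 4 ^ k * ((2 * cantorHalfSide p k) ^ 2 * (k * (Real.log 4 / 2)) ^ (2 * p)) := by
        rw [two_mul_cantorHalfSide, Real.mul_rpow hk'.le (by positivity),
          Real.div_rpow hL.le (by norm_num), h4, Real.rpow_neg (by norm_num)]
        have e1 := hsq _ hL
        have e2 := hsq _ hk'
        have h2 : (2 : ℝ) ^ (2 * p) ≠ 0 := by positivity
        have h3 : (2 : ℝ) ^ k ≠ 0 := by positivity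
        calc _ = ((Real.log 4 ^ (-p)) ^ 2 * Real.log 4 ^ (2 * p)) *
              (((k : ℝ) ^ (-p)) ^ 2 * (k : ℝ) ^ (2 * p)) * ((2 : ℝ) ^ (2 * p))⁻¹ := by
              rw [e1, e2]; ring
          _ = _ := by field_simp
    _ ≤ _ := by gcongr

/-- The `k`-th binary digit of `x`. -/
noncomputable def binaryDigit (x : ℝ) (k : ℕ) : Bool := decide (⌊2 ^ k * x⌋ % 2 = 1)

lemma digitSign_binaryDigit (x : ℝ) (k : ℕ) :
    digitSign (binaryDigit x (k + 1)) / 2 =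
      (⌊2 ^ (k + 1) * x⌋ : ℝ) - 2 * (⌊2 ^ k * x⌋ : ℝ) - 1 / 2 := by
  have h1 : 2 * ⌊2 ^ k * x⌋ ≤ ⌊2 ^ (k + 1) * x⌋ := by
    rw [Int.le_floor]; push_cast
    have := Int.floor_le (2 ^ k * x)
    rw [pow_succ]; linarith
  have h2 : ⌊2 ^ (k + 1) * x⌋ < 2 * ⌊2 ^ k * x⌋ + 2 := by
    rw [Int.floor_lt]; push_cast
    have := Int.lt_floor_add_one (2 ^ k * x)
    rw [pow_succ]; linarith
  unfold digitSign binaryDigit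
  generalize ⌊2 ^ (k + 1) * x⌋ = m at *
  generalize ⌊2 ^ k * x⌋ = n at *
  obtain rfl | rfl : m = 2 * n ∨ m = 2 * n + 1 := by omega
  · simp; norm_num
  · have : (2 * n + 1) % 2 = 1 := by omega
    simp [this]; norm_num

/-- The summands of a coordinate of `cantorPoint` at the binary digits of `x`. -/
noncomputable def cantorTerm (p x : ℝ) (k : ℕ) : ℝ :=
  if 2 ≤ k then digitSign (binaryDigit x k) * cantorHalfSide p k / 2 else 0

lemma abs_cantorTerm_le (p x : ℝ) {k : ℕ} (hk : 1 ≤ k) :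
    |cantorTerm p x k| ≤ cantorHalfSide p k / 2 := by
  have h0 := cantorHalfSide_pos p hk
  have hs : ∀ b, |digitSign b| = 1 := fun b => by cases b <;> simp [digitSign]
  unfold cantorTerm
  split_ifs
  · rw [mul_div_assoc, abs_mul, hs, one_mul, abs_of_pos (by positivity)]
  · simp; positivity

lemma summable_cantorTerm {p : ℝ} (hp : 0 < p) (x : ℝ) : Summable (cantorTerm p x) := by
  refine Summable.of_norm_bounded (g := fun k => (1 / 2 : ℝ) ^ k) summable_geometric_two ?_
  intro k
  rcases Nat.eq_zero_or_pos k with rfl | hk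
  · simp [cantorTerm]
  · have h1 := abs_cantorTerm_le p x hk
    have h2 := two_mul_cantorHalfSide_le hp hk
    have h3 := cantorHalfSide_pos p hk
    rw [Real.norm_eq_abs]; linarith

lemma abs_tsum_cantorTerm_sub_le {p : ℝ} (hp : 0 < p) (x : ℝ) {n : ℕ} (hn : 1 ≤ n) :
    |∑' k, cantorTerm p x k - ∑ k ∈ Finset.range (n + 1), cantorTerm p x k| ≤
      cantorHalfSide p n / 2 := by
  have key : ∀ m, n ≤ m → |∑ k ∈ Finset.range (m + 1), cantorTerm p x k -
      ∑ k ∈ Finset.range (n + 1), cantorTerm p x k| ≤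
      (cantorHalfSide p n - cantorHalfSide p m) / 2 := by
    intro m hm
    induction m, hm using Nat.le_induction with
    | base => simp
    | succ m hm ih =>
      rw [Finset.sum_range_succ]
      have h1 := abs_cantorTerm_le p x (show 1 ≤ m + 1 by omega)
      have h2 := cantorHalfSide_succ_le hp (hn.trans hm)
      rw [abs_le] at *
      constructor <;> linarith
  have hlim := ((summable_cantorTerm hp x).hasSum.tendsto_sum_nat.comp
    (tendsto_add_atTop_nat 1)).sub_const (∑ k ∈ Finset.range (n + 1), cantorTerm p x k)
  refine le_of_tendsto hlim.abs ?_
  filter_upwards [eventually_ge_atTop n] with m hm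
  have h1 := key m hm
  have h2 := cantorHalfSide_pos p (hn.trans hm)
  simp only [Function.comp_apply]
  linarith

lemma floor_sub_mul_le_sum_sub {p : ℝ} (hp : 0 < p) {x y : ℝ} (hx : x ∈ Set.Ico (0 : ℝ) (1 / 2))
    (hy : y ∈ Set.Ico (0 : ℝ) (1 / 2)) {n : ℕ} (hn : 1 ≤ n) (hxy : ⌊2 ^ n * y⌋ ≤ ⌊2 ^ n * x⌋) :
    ((⌊2 ^ n * x⌋ : ℝ) - ⌊2 ^ n * y⌋) * cantorHalfSide p n ≤
      ∑ k ∈ Finset.range (n + 1), cantorTerm p x k -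
        ∑ k ∈ Finset.range (n + 1), cantorTerm p y k := by
  induction n, hn using Nat.le_induction with
  | base =>
    have h : ∀ z ∈ Set.Ico (0 : ℝ) (1 / 2), ⌊(2 : ℝ) ^ 1 * z⌋ = 0 := fun z hz => by
      rw [Int.floor_eq_zero_iff]
      constructor <;> linarith [hz.1, hz.2]
    rw [h x hx, h y hy]
    simp [Finset.sum_range_succ, cantorTerm]
  | succ n hn ih =>
    have ex := digitSign_binaryDigit x n
    have ey := digitSign_binaryDigit y n
    have bx : |digitSign (binaryDigit x (n + 1))| = 1 := by
      cases binaryDigit x (n + 1) <;> simp [digitSign]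
    have bY : |digitSign (binaryDigit y (n + 1))| = 1 := by
      cases binaryDigit y (n + 1) <;> simp [digitSign]
    have hle : ⌊2 ^ n * y⌋ ≤ ⌊2 ^ n * x⌋ := by
      have hxy' : (⌊2 ^ (n + 1) * y⌋ : ℝ) ≤ ⌊2 ^ (n + 1) * x⌋ := by exact_mod_cast hxy
      have h1 := (abs_le.1 bx.le).2
      have h2 := (abs_le.1 bY.le).1
      have : (⌊2 ^ n * y⌋ : ℝ) < ⌊2 ^ n * x⌋ + 1 := by linarith
      have : ⌊2 ^ n * y⌋ < ⌊2 ^ n * x⌋ + 1 := by exact_mod_cast this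
      omega
    have ih := ih hle
    rw [Finset.sum_range_succ _ (n + 1), Finset.sum_range_succ _ (n + 1)]
    have tx : ∀ z, cantorTerm p z (n + 1) =
        digitSign (binaryDigit z (n + 1)) / 2 * cantorHalfSide p (n + 1) := fun z => by
      rw [cantorTerm, if_pos (by omega)]; ring
    rw [tx, tx, ex, ey]
    have h2 := cantorHalfSide_succ_le hp hn
    have hle' : (0 : ℝ) ≤ (⌊2 ^ n * x⌋ : ℝ) - ⌊2 ^ n * y⌋ := by
      rw [sub_nonneg]; exact_mod_cast hle
    have := mul_le_mul_of_nonneg_left h2 hle'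
    linarith

lemma abs_sub_le_of_abs_tsum_cantorTerm_sub_le {p : ℝ} (hp : 0 < p) {x y : ℝ}
    (hx : x ∈ Set.Ico (0 : ℝ) (1 / 2)) (hy : y ∈ Set.Ico (0 : ℝ) (1 / 2)) {n : ℕ} (hn : 1 ≤ n)
    (h : |∑' k, cantorTerm p x k - ∑' k, cantorTerm p y k| ≤ 2 * cantorHalfSide p n) :
    |x - y| ≤ 4 / 2 ^ n := by
  wlog hxy : ⌊2 ^ n * y⌋ ≤ ⌊2 ^ n * x⌋ generalizing x y
  · rw [abs_sub_comm] at h ⊢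
    exact this hy hx h (le_of_not_ge hxy)
  have h0 := cantorHalfSide_pos p hn
  have h1 := floor_sub_mul_le_sum_sub hp hx hy hn hxy
  have h2 := abs_le.1 (abs_tsum_cantorTerm_sub_le hp x hn)
  have h3 := abs_le.1 (abs_tsum_cantorTerm_sub_le hp y hn)
  have h4 := abs_le.1 h
  have h5 : (⌊2 ^ n * x⌋ : ℝ) - ⌊2 ^ n * y⌋ ≤ 3 := by
    refine le_of_mul_le_mul_right ?_ h0
    linarith [h2.1, h2.2, h3.1, h3.2, h4.1, h4.2]
  have h6 : (⌊2 ^ n * y⌋ : ℝ) ≤ ⌊2 ^ n * x⌋ := by exact_mod_cast hxy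
  have f1 := Int.floor_le (2 ^ n * x)
  have f2 := Int.lt_floor_add_one (2 ^ n * x)
  have f3 := Int.floor_le (2 ^ n * y)
  have f4 := Int.lt_floor_add_one (2 ^ n * y)
  have h2n : (0 : ℝ) < 2 ^ n := by positivity
  have h7 : |(x - y) * 2 ^ n| ≤ 4 := by
    rw [abs_le]
    constructor <;> linarith
  rwa [abs_mul, abs_of_pos h2n, ← le_div_iff₀ h2n] at h7

/-- The point of the Cantor set addressed by the binary digits of the coordinates of `z`. -/
noncomputable def cantorParam (p : ℝ) (z : ℝ × ℝ) : ℝ × ℝ :=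
  cantorPoint p fun k => (binaryDigit z.1 k, binaryDigit z.2 k)

lemma volume_preimage_cantorParam_le {p : ℝ} (hp : 0 < p) {U : Set (ℝ × ℝ)} {n : ℕ} (hn : 1 ≤ n)
    (hU : Metric.ediam U ≤ ENNReal.ofReal (2 * cantorHalfSide p n)) :
    volume (cantorParam p ⁻¹' U ∩ Set.Ico (0 : ℝ) (1 / 2) ×ˢ Set.Ico (0 : ℝ) (1 / 2)) ≤
      ENNReal.ofReal (64 / 4 ^ n) := by
  have h0 := cantorHalfSide_pos p hn
  rcases (cantorParam p ⁻¹' U ∩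
    Set.Ico (0 : ℝ) (1 / 2) ×ˢ Set.Ico (0 : ℝ) (1 / 2)).eq_empty_or_nonempty with he | ⟨w, hw, hwI⟩
  · rw [he, measure_empty]; exact zero_le
  have hsub : cantorParam p ⁻¹' U ∩ Set.Ico (0 : ℝ) (1 / 2) ×ˢ Set.Ico (0 : ℝ) (1 / 2) ⊆
      Metric.closedBall w.1 (4 / 2 ^ n) ×ˢ Metric.closedBall w.2 (4 / 2 ^ n) := by
    rintro z ⟨hz, hzI⟩
    have hd : dist (cantorParam p z) (cantorParam p w) ≤ 2 * cantorHalfSide p n := by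
      have := (Metric.edist_le_ediam_of_mem (Set.mem_preimage.1 hz) (Set.mem_preimage.1 hw)).trans hU
      rwa [edist_dist, ENNReal.ofReal_le_ofReal_iff (by positivity)] at this
    rw [Prod.dist_eq, max_le_iff] at hd
    exact ⟨abs_sub_le_of_abs_tsum_cantorTerm_sub_le hp hzI.1 hwI.1 hn hd.1,
      abs_sub_le_of_abs_tsum_cantorTerm_sub_le hp hzI.2 hwI.2 hn hd.2⟩
  refine (measure_mono hsub).trans_eq ?_
  rw [Measure.volume_eq_prod, Measure.prod_prod, Real.volume_closedBall, Real.volume_closedBall,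
    ← ENNReal.ofReal_mul (by positivity)]
  congr 1
  rw [show (4 : ℝ) ^ n = 2 ^ n * 2 ^ n by rw [← mul_pow]; norm_num]
  field_simp
  norm_num

lemma exists_cantorHalfSide_scale {p : ℝ} (hp : 0 < p) {d : ℝ} (hd : 0 < d)
    (hd1 : d ≤ 2 * cantorHalfSide p 1) :
    ∃ n : ℕ, 1 ≤ n ∧ 2 * cantorHalfSide p (n + 1) < d ∧ d ≤ 2 * cantorHalfSide p n := by
  classical
  have hex : ∃ m : ℕ, 2 * cantorHalfSide p (m + 2) < d := by
    obtain ⟨m, hm⟩ := exists_pow_lt_of_lt_one hd (show (1 / 2 : ℝ) < 1 by norm_num)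
    refine ⟨m, (two_mul_cantorHalfSide_le hp (by omega)).trans_lt (lt_of_le_of_lt ?_ hm)⟩
    exact pow_le_pow_of_le_one (by norm_num) (by norm_num) (by omega)
  refine ⟨Nat.find hex + 1, by omega, Nat.find_spec hex, ?_⟩
  rcases h : Nat.find hex with _ | m
  · exact hd1
  · exact not_lt.1 (Nat.find_min hex (m := m) (by omega))

lemma le_four_pow_mul_gauge_of_mem {p : ℝ} (hp : 0 < p) {n : ℕ} (hn : 1 ≤ n) {d : ℝ}
    (hd : 2 * cantorHalfSide p (n + 1) < d) (hd' : d ≤ 2 * cantorHalfSide p n) :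
    2 ^ (-(2 * p)) * (2 ^ (-p) / 2) ^ 2 ≤ 4 ^ n * cantorGauge p d := by
  have h0 := cantorHalfSide_pos p hn
  have h1 := cantorHalfSide_pos p (show 1 ≤ n + 1 by omega)
  have hdpos : 0 < d := by linarith
  have hL : 0 < Real.log 4 := one_pos.trans one_lt_log_four
  have hlog0 : 0 ≤ Real.log (1 / (2 * cantorHalfSide p n)) :=
    le_trans (by positivity) (le_log_inv_cantorHalfSide hp hn)
  have hlog : Real.log (1 / (2 * cantorHalfSide p n)) ≤ Real.log (1 / d) :=
    Real.log_le_log (by positivity) (by gcongr)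
  have hside : 2 ^ (-p) / 2 * (2 * cantorHalfSide p n) ≤ d := by
    linarith [le_cantorHalfSide_succ hp hn]
  calc (2 : ℝ) ^ (-(2 * p)) * (2 ^ (-p) / 2) ^ 2
      ≤ 4 ^ n * cantorGauge p (2 * cantorHalfSide p n) * (2 ^ (-p) / 2) ^ 2 := by
        gcongr; exact le_four_pow_mul_gauge hp hn
    _ = 4 ^ n * ((2 ^ (-p) / 2 * (2 * cantorHalfSide p n)) ^ 2 *
          Real.log (1 / (2 * cantorHalfSide p n)) ^ (2 * p)) := by
        unfold cantorGauge; ring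
    _ ≤ 4 ^ n * cantorGauge p d := by
        unfold cantorGauge; gcongr

/-- The mass distribution estimate. -/
lemma exists_volume_preimage_cantorParam_le_gauge {p : ℝ} (hp : 0 < p) :
    ∃ C : ℝ, 0 < C ∧ ∀ U : Set (ℝ × ℝ),
      Metric.ediam U ≤ ENNReal.ofReal (2 * cantorHalfSide p 1) →
      volume (cantorParam p ⁻¹' U ∩ Set.Ico (0 : ℝ) (1 / 2) ×ˢ Set.Ico (0 : ℝ) (1 / 2)) ≤
        ENNReal.ofReal C * ENNReal.ofReal (cantorGauge p (Metric.ediam U).toReal) := by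
  have hc : (0 : ℝ) < 2 ^ (-(2 * p)) * (2 ^ (-p) / 2) ^ 2 := by positivity
  set c : ℝ := 2 ^ (-(2 * p)) * (2 ^ (-p) / 2) ^ 2
  refine ⟨64 / c, by positivity, fun U hU => ?_⟩
  have hfin : Metric.ediam U ≠ ⊤ := ne_top_of_le_ne_top ENNReal.ofReal_ne_top hU
  have hUd : Metric.ediam U = ENNReal.ofReal (Metric.ediam U).toReal :=
    (ENNReal.ofReal_toReal hfin).symm
  rcases (ENNReal.toReal_nonneg (a := Metric.ediam U)).eq_or_lt with h0 | hpos
  · have hlim : Tendsto (fun n : ℕ => ENNReal.ofReal (64 / 4 ^ n)) atTop (𝓝 0) := by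
      rw [← ENNReal.ofReal_zero]
      refine (ENNReal.continuous_ofReal.tendsto 0).comp ?_
      exact tendsto_const_nhds.div_atTop (tendsto_pow_atTop_atTop_of_one_lt (by norm_num))
    refine le_trans (ge_of_tendsto hlim ?_) zero_le
    filter_upwards [eventually_ge_atTop 1] with n hn
    refine volume_preimage_cantorParam_le hp hn ?_
    rw [hUd, ← h0]; simp
  · have hd1 : (Metric.ediam U).toReal ≤ 2 * cantorHalfSide p 1 :=
      ENNReal.toReal_le_of_le_ofReal (by linarith [cantorHalfSide_pos p le_rfl]) hU
    obtain ⟨n, hn, hlt, hle⟩ := exists_cantorHalfSide_scale hp hpos hd1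
    refine (volume_preimage_cantorParam_le hp hn ?_).trans ?_
    · rw [hUd]; exact ENNReal.ofReal_le_ofReal hle
    · rw [← ENNReal.ofReal_mul (by positivity)]
      refine ENNReal.ofReal_le_ofReal ?_
      have := le_four_pow_mul_gauge_of_mem hp hn hlt hle
      rw [div_mul_eq_mul_div, div_le_div_iff₀ (by positivity) hc]
      change c ≤ _ at this
      linarith

lemma cantorHausdorffMeasure_range_pos {p : ℝ} (hp : 0 < p) :
    0 < cantorHausdorffMeasure p (Set.range (cantorPoint p)) := by
  obtain ⟨C, hC, hmass⟩ := exists_volume_preimage_cantorParam_le_gauge hp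
  have hr := cantorHalfSide_pos p le_rfl
  have hlow : ENNReal.ofReal (1 / 4) / ENNReal.ofReal C ≤
      cantorHausdorffMeasure p (Set.range (cantorPoint p)) := by
    rw [cantorHausdorffMeasure, Measure.mkMetric_apply]
    refine le_iSup₂_of_le (ENNReal.ofReal (2 * cantorHalfSide p 1))
      (ENNReal.ofReal_pos.2 (by positivity)) (le_iInf₂ fun t ht => le_iInf fun htd => ?_)
    refine ENNReal.div_le_of_le_mul' ?_
    have hcov : Set.Ico (0 : ℝ) (1 / 2) ×ˢ Set.Ico (0 : ℝ) (1 / 2) ⊆ ⋃ n, cantorParam p ⁻¹' t n ∩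
        Set.Ico (0 : ℝ) (1 / 2) ×ˢ Set.Ico (0 : ℝ) (1 / 2) := fun z hz => by
      obtain ⟨n, hn⟩ := Set.mem_iUnion.1 (ht ⟨_, rfl⟩ : cantorParam p z ∈ ⋃ n, t n)
      exact Set.mem_iUnion.2 ⟨n, hn, hz⟩
    calc ENNReal.ofReal (1 / 4)
        = volume (Set.Ico (0 : ℝ) (1 / 2) ×ˢ Set.Ico (0 : ℝ) (1 / 2)) := by
          rw [Measure.volume_eq_prod, Measure.prod_prod, Real.volume_Ico,
            ← ENNReal.ofReal_mul (by norm_num)]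
          norm_num
      _ ≤ _ := (measure_mono hcov).trans (measure_iUnion_le _)
      _ ≤ _ := by
          rw [← ENNReal.tsum_mul_left]
          refine ENNReal.tsum_le_tsum fun n => ?_
          rcases (t n).eq_empty_or_nonempty with he | hne
          · simp [he]
          · rw [iSup_pos hne]
            exact hmass _ (htd n)
  exact (ENNReal.div_pos (by simp) ENNReal.ofReal_ne_top).trans_le hlow

/-- for `p > 1/2`, `0 < r'_k < R'_k`, the generations nest
(`R'_{k+1} < r'_k`), `4^k g(2 r'_k)` is bounded below by a positive constant,
and consequently the Cantor set 𝒞' built with `4^k` squares of side `2r'_k` in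
generation `k` has positive `H^g` measure. -/
theorem cantor_set_positive_gauge_measure (p : ℝ) (hp : 1/2 < p) :
    (∀ k : ℕ, 2 ≤ k → 0 < cantorHalfSide p k ∧ cantorHalfSide p k < cantorOuterHalfSide p k) ∧
    (∀ k : ℕ, 2 ≤ k → cantorOuterHalfSide p (k + 1) < cantorHalfSide p k) ∧
    (∃ c : ℝ, 0 < c ∧ ∃ K : ℕ, ∀ k : ℕ, K ≤ k →
        c ≤ 4 ^ k * cantorGauge p (2 * cantorHalfSide p k)) ∧
    0 < cantorHausdorffMeasure p (Set.range (cantorPoint p)) := by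
  have hp0 : 0 < p := by linarith
  refine ⟨fun k hk => ⟨cantorHalfSide_pos p (by omega), cantorHalfSide_lt_outer hp0 hk⟩,
    fun k hk => ?_, ⟨2 ^ (-(2 * p)), by positivity, 1, fun k hk => le_four_pow_mul_gauge hp0 hk⟩,
    cantorHausdorffMeasure_range_pos hp0⟩
  rw [cantorOuterHalfSide_succ]
  linarith [cantorHalfSide_pos p (show 1 ≤ k by omega)]
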